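/- Let W = (W_β)_{β∈ℝ} be any V-lattice filtration on N = N₁ ⊗_{ℂ[z,z⁻¹]} N₂ that is stable under ∇ and satisfies (∇ + β·id)^ν(W_β) ⊆ W_{<β} for some ν ∈ ℕ and all β ∈ ℝ. Then for every β ∈ ℝ the Harder–Narasimhan filtration of M = M₁ ⊗_{ℂ[z]} M₂ satisfies F^HN_β M := ℂ[z]·(W_β ∩ M) = Σ_{β₁+β₂=β} (image in M of F^HN_{β₁} M₁ ⊗_{ℂ[z]} F^HN_{β₂} M₂), where F^HN_{β_i} M_i := ℂ[z]·(Vⁱ_{β_i} ∩ M_i). (Remark 3.2.12 of 'Irregular Hodge theory': tensor product formula for the Harder–Narasimhan filtration.) -/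

import Mathlib

noncomputable section

open Submodule Set LaurentPolynomial

open scoped TensorProduct

/-- The ring `ℂ[z,z⁻¹]` of Laurent polynomials. -/
abbrev L : Type := LaurentPolynomial ℂ

variable {N : Type*} [AddCommGroup N] [Module ℂ N]

/-- `M` is (the image of) a finite free `ℂ[z]`-module of rank `r` inside
`N = ℂ[z,z⁻¹] ⊗_{ℂ[z]} M`, where multiplication by `z` is the automorphism `z` of `N`.
This is encoded by `z`-stability of `M` together with the existence of an `r`-element
family `b` of elements of `M` such that `(z^k (b i))` for `k ∈ ℤ` is a `ℂ`-basis of `N`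
and `(z^k (b i))` for `k ∈ ℕ` is a `ℂ`-basis of `M`. -/
def IsFreeLattice (z : N ≃ₗ[ℂ] N) (M : Submodule ℂ N) (r : ℕ) : Prop :=
  (∀ x ∈ M, z x ∈ M) ∧
  ∃ b : Fin r → N,
    LinearIndependent ℂ (fun p : Fin r × ℤ => (z ^ p.2) (b p.1)) ∧
    Submodule.span ℂ (Set.range fun p : Fin r × ℤ => (z ^ p.2) (b p.1)) = ⊤ ∧
    Submodule.span ℂ (Set.range fun p : Fin r × ℕ => (z ^ (p.2 : ℤ)) (b p.1)) = M

/-- A V-lattice filtration on `N` (with jumps in `A + ℤ`, `A ⊆ [0,1)` finite):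
(i) increasing; (ii) `z · V_β = V_{β+1}`; (iii) each `V_β` is stable under `z⁻¹` and
finitely generated over `ℂ[z⁻¹]`; (iv) the `ℂ[z,z⁻¹]`-span of each `V_β` is `N`;
(v) `V_β = V_γ` if `(β,γ] ∩ (A + ℤ) = ∅`. -/
structure IsVLattice (z : N ≃ₗ[ℂ] N) (V : ℝ → Submodule ℂ N) (A : Finset ℝ) : Prop where
  mono : Monotone V
  map_z : ∀ β : ℝ, (V β).map z.toLinearMap = V (β + 1)
  zinv_stable : ∀ β : ℝ, ∀ x ∈ V β, z.symm x ∈ V β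
  fg_zinv : ∀ β : ℝ, ∃ S : Finset N, (S : Set N) ⊆ (V β : Set N) ∧
    V β = Submodule.span ℂ {x : N | ∃ k : ℕ, ∃ s ∈ S, x = (z.symm ^ k) s}
  span_laurent : ∀ β : ℝ, Submodule.span ℂ {x : N | ∃ k : ℤ, ∃ v ∈ V β, x = (z ^ k) v} = ⊤
  jumpsIn : ∀ a ∈ A, (0 : ℝ) ≤ a ∧ a < 1
  jumps : ∀ β γ : ℝ, β ≤ γ →
    (∀ a ∈ A, ∀ k : ℤ, ¬ (β < a + k ∧ a + k ≤ γ)) → V β = V γ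

/-- `V_{<β} := ⋃_{γ < β} V_γ`. -/
def Vlt (V : ℝ → Submodule ℂ N) (β : ℝ) : Submodule ℂ N := ⨆ γ ∈ Set.Iio β, V γ

/-- Multiplication by `z` (the Laurent variable `T 1`) as a `ℂ`-linear automorphism of a
`ℂ[z,z⁻¹]`-module. -/
def zmul (N : Type*) [AddCommGroup N] [Module L N] [Module ℂ N] [IsScalarTower ℂ L N] :
    N ≃ₗ[ℂ] N where
  toFun x := (T 1 : L) • x
  invFun x := (T (-1) : L) • x
  map_add' x y := smul_add _ x y
  map_smul' c x := smul_comm (T 1 : L) c x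
  left_inv x := by show (T (-1) : L) • (T 1 : L) • x = x; rw [smul_smul, ← T_add]; simp
  right_inv x := by show (T 1 : L) • (T (-1) : L) • x = x; rw [smul_smul, ← T_add]; simp

/-- `F^HN_β M := ℂ[z]·(V_β ∩ M)`, the `ℂ[z]`-submodule of `M` generated by `V_β ∩ M`. -/
def FHNpoly (z : N ≃ₗ[ℂ] N) (V : ℝ → Submodule ℂ N) (M : Submodule ℂ N) (β : ℝ) :
    Submodule ℂ N :=
  Submodule.span ℂ {x : N | ∃ k : ℕ, ∃ v ∈ V β ⊓ M, x = (z ^ (k : ℤ)) v}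

section LaurentModule

set_option linter.unusedSectionVars false

variable {N : Type*} [AddCommGroup N] [Module L N] [Module ℂ N] [IsScalarTower ℂ L N]
variable {ι : Type*}

lemma zmul_apply (x : N) : zmul N x = (T 1 : L) • x := rfl

lemma zmul_symm_apply (x : N) : (zmul N).symm x = (T (-1) : L) • x := rfl

lemma zmul_symm_pow_apply (k : ℕ) (x : N) :
    (((zmul N).symm) ^ k) x = (T (-(k : ℤ)) : L) • x := by
  induction k with
  | zero => simp
  | succ k ih =>
    rw [pow_succ', LinearEquiv.mul_apply, ih, zmul_symm_apply, smul_smul, ← T_add]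
    congr 2
    push_cast
    ring

lemma zmul_zpow_apply (k : ℤ) (x : N) : ((zmul N) ^ k) x = (T k : L) • x := by
  have key : ∀ n : ℕ, ∀ x : N, ((zmul N) ^ n) x = (T (n : ℤ) : L) • x := by
    intro n
    induction n with
    | zero => intro x; simp
    | succ n ih =>
      intro x
      rw [pow_succ', LinearEquiv.mul_apply, ih, zmul_apply, smul_smul, ← T_add]
      congr 2
      push_cast
      ring
  obtain ⟨n, rfl | rfl⟩ := k.eq_nat_or_neg
  · rw [zpow_natCast, key]
  · rw [zpow_neg, zpow_natCast, ← inv_pow]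
    exact zmul_symm_pow_apply n x

lemma T_smul_T_smul (a b : ℤ) (x : N) : (T a : L) • (T b : L) • x = (T (a + b) : L) • x := by
  rw [smul_smul, ← T_add]

/-- Multiplication by `z ^ k` as a `ℂ`-linear map. -/
def Tmap (N : Type*) [AddCommGroup N] [Module L N] [Module ℂ N] [IsScalarTower ℂ L N] (k : ℤ) :
    N →ₗ[ℂ] N where
  toFun x := (T k : L) • x
  map_add' x y := smul_add _ x y
  map_smul' c x := smul_comm (T k : L) c x

@[simp] lemma Tmap_apply (k : ℤ) (x : N) : Tmap N k x = (T k : L) • x := rfl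

/-- The family `z ^ k • m i`. -/
def monomials (m : ι → N) (p : ι × ℤ) : N := (T p.2 : L) • m p.1

/-- The `ℂ`-span of the `z ^ k • m i` with `(i, k) ∈ S`. -/
def monomialSpan (m : ι → N) (S : Set (ι × ℤ)) : Submodule ℂ N :=
  span ℂ (monomials m '' S)

lemma monomialSpan_le {m : ι → N} {S : Set (ι × ℤ)} {Q : Submodule ℂ N} :
    monomialSpan m S ≤ Q ↔ ∀ p ∈ S, (T p.2 : L) • m p.1 ∈ Q := by
  rw [monomialSpan, span_le, Set.image_subset_iff]
  rfl

lemma smul_mem_monomialSpan {m : ι → N} {S : Set (ι × ℤ)} {i : ι} {k : ℤ} (h : (i, k) ∈ S) :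
    (T k : L) • m i ∈ monomialSpan m S :=
  subset_span ⟨(i, k), h, rfl⟩

lemma monomialSpan_mono {m : ι → N} {S S' : Set (ι × ℤ)} (h : S ⊆ S') :
    monomialSpan m S ≤ monomialSpan m S' :=
  span_mono (Set.image_mono h)

lemma T_smul_mem_monomialSpan {m : ι → N} {S S' : Set (ι × ℤ)} {k : ℤ}
    (h : ∀ p ∈ S, (p.1, k + p.2) ∈ S') {x : N} (hx : x ∈ monomialSpan m S) :
    (T k : L) • x ∈ monomialSpan m S' := by
  have : monomialSpan m S ≤ (monomialSpan m S').comap (Tmap N k) := by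
    rw [monomialSpan_le]
    intro p hp
    rw [mem_comap, Tmap_apply, T_smul_T_smul]
    exact smul_mem_monomialSpan (h p hp)
  exact this hx

lemma self_mem_monomialSpan (m : ι → N) (i : ι) : m i ∈ monomialSpan m {p | 0 ≤ p.2} := by
  have h := smul_mem_monomialSpan (m := m) (S := {p | 0 ≤ p.2}) (i := i) (k := 0)
    (show (0 : ℤ) ≤ 0 from le_rfl)
  rwa [T_zero, one_smul] at h

lemma T_smul_mem_monomialSpan_nonneg {m : ι → N} {k : ℤ} (hk : 0 ≤ k) {x : N}
    (hx : x ∈ monomialSpan m {p | 0 ≤ p.2}) :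
    (T k : L) • x ∈ monomialSpan m {p | 0 ≤ p.2} := by
  refine T_smul_mem_monomialSpan (fun q (hq : 0 ≤ q.2) => ?_) hx
  show 0 ≤ k + q.2
  omega

lemma monomialSpan_nonneg_le {m m' : ι → N}
    (h : ∀ j, m j ∈ monomialSpan m' {p | 0 ≤ p.2}) :
    monomialSpan m {p | 0 ≤ p.2} ≤ monomialSpan m' {p | 0 ≤ p.2} := by
  rw [monomialSpan_le]
  intro p hp
  exact T_smul_mem_monomialSpan_nonneg hp (h p.1)

/-- The `ℂ`-basis `z ^ k • e i` attached to a `ℂ[z,z⁻¹]`-basis `e`. -/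
def monomialBasis (e : Module.Basis ι L N) : Module.Basis (ι × ℤ) ℂ N :=
  ((AddMonoidAlgebra.basis ℤ ℂ : Module.Basis ℤ ℂ L).smulTower e).reindex (Equiv.prodComm _ _)

lemma coe_monomialBasis (e : Module.Basis ι L N) : ⇑(monomialBasis e) = monomials e := by
  funext p
  simp only [monomialBasis, Module.Basis.reindex_apply, Module.Basis.smulTower_apply, monomials]
  erw [AddMonoidAlgebra.basis_apply]
  rfl

lemma mem_monomialSpan (e : Module.Basis ι L N) {S : Set (ι × ℤ)} {x : N} :
    x ∈ monomialSpan e S ↔ ↑((monomialBasis e).repr x).support ⊆ S := by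
  rw [monomialSpan, ← coe_monomialBasis, Module.Basis.mem_span_image]

lemma monomialSpan_inf (e : Module.Basis ι L N) (S S' : Set (ι × ℤ)) :
    monomialSpan e S ⊓ monomialSpan e S' = monomialSpan e (S ∩ S') := by
  ext x
  simp only [mem_inf, mem_monomialSpan, Set.subset_inter_iff]

lemma monomialSpan_univ (e : Module.Basis ι L N) : monomialSpan e Set.univ = ⊤ := by
  ext x
  simp [mem_monomialSpan]

lemma exists_basis_of_monomials [Fintype ι] (b : ι → N)
    (hli : LinearIndependent ℂ (monomials b))
    (hsp : span ℂ (Set.range (monomials b)) = ⊤) :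
    ∃ e : Module.Basis ι L N, ⇑e = b := by
  classical
  let B : Module.Basis (ι × ℤ) ℂ N := Module.Basis.mk hli hsp.ge
  let P := monomialBasis (Pi.basisFun L ι)
  let g : (ι → L) →ₗ[L] N := Fintype.linearCombination L b
  have hg : g.restrictScalars ℂ = (P.equiv B (Equiv.refl _)).toLinearMap := by
    refine P.ext fun p => ?_
    have h1 : P p = (T p.2 : L) • (Pi.basisFun L ι) p.1 := by
      change monomialBasis _ p = _
      rw [coe_monomialBasis]; rfl
    rw [LinearEquiv.coe_coe, Module.Basis.equiv_apply, LinearMap.restrictScalars_apply, h1, map_smul]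
    simp [B, g, Fintype.linearCombination_apply_single, monomials]
  have hbij : Function.Bijective g := by
    have : ⇑g = ⇑(P.equiv B (Equiv.refl _)) := congrArg DFunLike.coe hg
    rw [this]
    exact LinearEquiv.bijective _
  refine ⟨Module.Basis.ofEquivFun (LinearEquiv.ofBijective g hbij).symm, ?_⟩
  funext i
  simp [g, Fintype.linearCombination_apply_single]

lemma exists_basis_of_monomialSpan_eq [Fintype ι] (e : Module.Basis ι L N) (m : ι → N)
    (h : monomialSpan m {p | 0 ≤ p.2} = monomialSpan e {p | 0 ≤ p.2}) :
    ∃ e' : Module.Basis ι L N, ⇑e' = m := by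
  have htop : ⊤ ≤ span L (Set.range m) := by
    rw [← e.span_eq, span_le]
    rintro _ ⟨i, rfl⟩
    have h1 : e i ∈ monomialSpan m {p | 0 ≤ p.2} := by
      rw [h]
      exact self_mem_monomialSpan e i
    have h2 : monomialSpan m {p | 0 ≤ p.2} ≤ (span L (Set.range m)).restrictScalars ℂ := by
      rw [monomialSpan_le]
      intro p _
      exact Submodule.smul_mem _ _ (subset_span (Set.mem_range_self p.1))
    exact h2 h1
  let f : N →ₗ[L] N := e.constr ℂ m
  have hf : ∀ i, f (e i) = m i := fun i => e.constr_basis ℂ m i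
  have hsurj : Function.Surjective f := by
    rw [← LinearMap.range_eq_top, eq_top_iff]
    refine htop.trans (span_le.2 ?_)
    rintro _ ⟨i, rfl⟩
    exact LinearMap.mem_range.2 ⟨e i, hf i⟩
  have : Module.Finite L N := Module.Finite.of_basis e
  have hinj := OrzechProperty.injective_of_surjective_endomorphism f hsurj
  refine ⟨e.map (LinearEquiv.ofBijective f ⟨hinj, hsurj⟩), ?_⟩
  funext i
  exact hf i

lemma IsFreeLattice.exists_basis {M : Submodule ℂ N} {r : ℕ} (h : IsFreeLattice (zmul N) M r) :
    ∃ e : Module.Basis (Fin r) L N, M = monomialSpan e {p | 0 ≤ p.2} := by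
  obtain ⟨-, b, hli, hsp, hM⟩ := h
  simp only [zmul_zpow_apply] at hli hsp hM
  obtain ⟨e, rfl⟩ := exists_basis_of_monomials b hli hsp
  refine ⟨e, ?_⟩
  rw [← hM, monomialSpan]
  congr 1
  ext x
  constructor
  · rintro ⟨p, rfl⟩
    exact ⟨(p.1, p.2), by simp, rfl⟩
  · rintro ⟨⟨i, k⟩, hk, rfl⟩
    obtain ⟨n, rfl⟩ := Int.eq_ofNat_of_zero_le hk
    exact ⟨(i, n), rfl⟩

lemma mem_Vlt {V : ℝ → Submodule ℂ N} (hV : Monotone V) {β : ℝ} {x : N} :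
    x ∈ Vlt V β ↔ ∃ γ < β, x ∈ V γ := by
  rw [Vlt]
  have : Nonempty (Set.Iio β) := ⟨⟨β - 1, by simp⟩⟩
  rw [iSup_subtype', mem_iSup_of_directed]
  · simp
  · exact Monotone.directed_le fun a b hab => hV hab

/-- The elements of `(A + ℤ) ∩ (a, b]`. -/
def jumpSet (A : Finset ℝ) (a b : ℝ) : Set ℝ :=
  {t | a < t ∧ t ≤ b ∧ ∃ c ∈ A, ∃ k : ℤ, t = c + k}

lemma jumpSet_finite (A : Finset ℝ) (a b : ℝ) : (jumpSet A a b).Finite := by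
  refine (A.finite_toSet.biUnion (t := fun c =>
    (fun k : ℤ => c + (k : ℝ)) '' Set.Icc ⌊a - c⌋ ⌈b - c⌉) fun c _ =>
      (Set.finite_Icc _ _).image _).subset ?_
  rintro t ⟨h1, h2, c, hc, k, rfl⟩
  simp only [Set.mem_iUnion]
  refine ⟨c, hc, k, ⟨?_, ?_⟩, rfl⟩
  · exact_mod_cast (Int.floor_le (a - c)).trans (by linarith : a - c ≤ (k : ℝ))
  · exact_mod_cast (by linarith : (k : ℝ) ≤ b - c).trans (Int.le_ceil (b - c))

lemma ncard_jumpSet_lt {A : Finset ℝ} {a b t b' : ℝ} (ht : t ∈ jumpSet A a b) (h : b' < t) :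
    (jumpSet A a b').ncard < (jumpSet A a b).ncard := by
  refine Set.ncard_lt_ncard ⟨?_, fun hsub => ?_⟩ (jumpSet_finite _ _ _)
  · rintro u ⟨h1, h2, h3⟩
    exact ⟨h1, (h2.trans h.le).trans ht.2.1, h3⟩
  · exact absurd (hsub ht).2.1 (not_le.2 h)

namespace IsVLattice

variable {V : ℝ → Submodule ℂ N} {A : Finset ℝ}

lemma eq_of_jumpSet_eq_empty (hV : IsVLattice (zmul N) V A) {a b : ℝ} (hab : a ≤ b)
    (h : jumpSet A a b = ∅) : V a = V b := by
  refine hV.jumps a b hab fun c hc k hk => ?_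
  have : c + (k : ℝ) ∈ jumpSet A a b := ⟨hk.1, hk.2, c, hc, k, rfl⟩
  rw [h] at this
  exact this

lemma exists_max_jump (hV : IsVLattice (zmul N) V A) {a b : ℝ} (h : (jumpSet A a b).Nonempty) :
    ∃ t ∈ jumpSet A a b, V t = V b := by
  obtain ⟨t, ht, hmax⟩ := Set.exists_max_image _ id (jumpSet_finite A a b) h
  refine ⟨t, ht, hV.eq_of_jumpSet_eq_empty ht.2.1 ?_⟩
  rw [Set.eq_empty_iff_forall_notMem]
  rintro u ⟨h1, h2, h3⟩
  exact absurd (hmax u ⟨ht.1.trans h1, h2, h3⟩) (not_le.2 h1)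

lemma exists_jump_of_mem (hV : IsVLattice (zmul N) V A) {a b : ℝ} {x : N} (hb : x ∈ V b)
    (ha : x ∉ V a) : ∃ t ∈ jumpSet A a b, x ∈ V t := by
  have hab : a ≤ b := by
    by_contra! h
    exact ha (hV.mono h.le hb)
  rcases (jumpSet A a b).eq_empty_or_nonempty with h | h
  · exact absurd (hV.eq_of_jumpSet_eq_empty hab h ▸ hb) ha
  · obtain ⟨t, ht, hVt⟩ := hV.exists_max_jump h
    exact ⟨t, ht, hVt ▸ hb⟩

lemma T_smul_mem (hV : IsVLattice (zmul N) V A) {β : ℝ} {x : N} (hx : x ∈ V β) (k : ℤ) :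
    (T k : L) • x ∈ V (β + k) := by
  have hpos : ∀ (n : ℕ) (β : ℝ) (x : N), x ∈ V β → (T (n : ℤ) : L) • x ∈ V (β + n) := by
    intro n
    induction n with
    | zero => intro β x hx; simpa using hx
    | succ n ih =>
      intro β x hx
      have h1 : (T 1 : L) • (T (n : ℤ) : L) • x ∈ V (β + n + 1) := by
        rw [← hV.map_z]
        exact ⟨_, ih β x hx, rfl⟩
      rw [T_smul_T_smul] at h1
      have h2 : ((n + 1 : ℕ) : ℤ) = 1 + n := by push_cast; ring
      have h3 : β + ((n + 1 : ℕ) : ℝ) = β + n + 1 := by push_cast; ring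
      rwa [h2, h3]
  have hneg : ∀ (n : ℕ) (β : ℝ) (x : N), x ∈ V β → (T (-(n : ℤ)) : L) • x ∈ V (β - n) := by
    intro n
    induction n with
    | zero => intro β x hx; simpa using hx
    | succ n ih =>
      intro β x hx
      have h1 := ih β x hx
      have h2 : V (β - n) = (V (β - n - 1)).map (zmul N).toLinearMap := by
        rw [hV.map_z]; congr 1; ring
      rw [h2] at h1
      obtain ⟨y, hy, hyx⟩ := h1
      have h3 : (T (-((n + 1 : ℕ) : ℤ)) : L) • x = y := by
        have : (T (-1) : L) • (T (-(n : ℤ)) : L) • x = (T (-1) : L) • (T 1 : L) • y :=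
          congrArg _ hyx.symm
        rw [T_smul_T_smul, T_smul_T_smul] at this
        simp only [Int.reduceNeg, neg_add_cancel, T_zero, one_smul] at this
        rw [← this]
        congr 2
        push_cast; ring
      have h4 : β - ((n + 1 : ℕ) : ℝ) = β - n - 1 := by push_cast; ring
      rw [h3, h4]
      exact hy
  obtain ⟨n, rfl | rfl⟩ := k.eq_nat_or_neg
  · simpa using hpos n β x hx
  · simpa [sub_eq_add_neg] using hneg n β x hx

lemma exists_mem (hV : IsVLattice (zmul N) V A) (x : N) : ∃ c, x ∈ V c := by
  have hx : x ∈ (⊤ : Submodule ℂ N) := trivial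
  rw [← hV.span_laurent 0] at hx
  induction hx using span_induction with
  | mem x hx =>
    obtain ⟨k, v, hv, rfl⟩ := hx
    rw [zmul_zpow_apply]
    exact ⟨_, hV.T_smul_mem hv k⟩
  | zero => exact ⟨0, zero_mem _⟩
  | add x y _ _ hx hy =>
    obtain ⟨c, hc⟩ := hx
    obtain ⟨c', hc'⟩ := hy
    exact ⟨max c c', add_mem (hV.mono (le_max_left _ _) hc) (hV.mono (le_max_right _ _) hc')⟩
  | smul a x _ hx =>
    obtain ⟨c, hc⟩ := hx
    exact ⟨c, Submodule.smul_mem _ _ hc⟩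

lemma exists_le (hV : IsVLattice (zmul N) V A) {Q : ℝ → Submodule ℂ N} (hQ : Monotone Q)
    (hex : ∀ x, ∃ c, x ∈ Q c) (hstab : ∀ c, ∀ x ∈ Q c, (T (-1) : L) • x ∈ Q c) (β : ℝ) :
    ∃ c, V β ≤ Q c := by
  obtain ⟨S, -, hS⟩ := hV.fg_zinv β
  choose f hf using hex
  obtain ⟨c, hc⟩ := (S.image f).bddAbove
  refine ⟨c, ?_⟩
  rw [hS, span_le]
  rintro _ ⟨k, s, hs, rfl⟩
  have hsc : s ∈ Q c := hQ (hc (by simpa using ⟨s, hs, rfl⟩)) (hf s)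
  induction k with
  | zero => simpa using hsc
  | succ k ih =>
    rw [pow_succ', LinearEquiv.mul_apply]
    exact hstab c _ ih

lemma exists_inf_eq_bot (hV : IsVLattice (zmul N) V A) [Finite ι] (e : Module.Basis ι L N) :
    ∃ α, V α ⊓ monomialSpan e {p | 0 ≤ p.2} = ⊥ := by
  obtain ⟨c, hc⟩ := hV.exists_le (Q := fun c => monomialSpan e {p | (p.2 : ℝ) ≤ c})
    (fun a b hab => monomialSpan_mono fun p (hp : (p.2 : ℝ) ≤ a) => hp.trans hab)
    (fun x => by
      obtain ⟨c, hc⟩ := (((monomialBasis e).repr x).support.image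
        fun p : ι × ℤ => (p.2 : ℝ)).bddAbove
      refine ⟨c, (mem_monomialSpan e).2 fun p hp => hc ?_⟩
      simp only [Finset.coe_image]
      exact ⟨p, hp, rfl⟩)
    (fun c x hx => T_smul_mem_monomialSpan (fun p (hp : (p.2 : ℝ) ≤ c) => by
      show ((-1 + p.2 : ℤ) : ℝ) ≤ c
      push_cast; linarith) hx) 0
  refine ⟨-((⌊c⌋ + 1 : ℤ) : ℝ), ?_⟩
  rw [eq_bot_iff]
  have hle : V (-((⌊c⌋ + 1 : ℤ) : ℝ)) ≤ monomialSpan e {p | p.2 < 0} := by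
    intro x hx
    have h1 := hV.T_smul_mem hx (⌊c⌋ + 1)
    rw [neg_add_cancel] at h1
    have h2 := T_smul_mem_monomialSpan (S' := {p | p.2 < 0}) (k := -(⌊c⌋ + 1))
      (fun p (hp : (p.2 : ℝ) ≤ c) => by
        have := Int.le_floor.2 hp
        show -(⌊c⌋ + 1) + p.2 < 0
        omega) (hc h1)
    rwa [T_smul_T_smul, neg_add_cancel, T_zero, one_smul] at h2
  refine (inf_le_inf_right _ hle).trans ?_
  rw [monomialSpan_inf, monomialSpan_le]
  rintro p ⟨h1, h2⟩
  exact absurd h1 (not_lt.2 (show 0 ≤ p.2 from h2))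

end IsVLattice

/-- The family `m` with exponents `d` is reduced with respect to `V`: no nontrivial homogeneous
combination of the `z ^ k • m i` has unexpectedly small order. -/
def IsReducedFamily (V : ℝ → Submodule ℂ N) (m : ι → N) (d : ι → ℝ) : Prop :=
  ∀ (δ : ℝ) (c : ι × ℤ →₀ ℂ), (∀ p ∈ c.support, (p.2 : ℝ) + d p.1 = δ) →
    Finsupp.linearCombination ℂ (monomials m) c ∈ Vlt V δ → c = 0

namespace IsVLattice

variable {V : ℝ → Submodule ℂ N} {A : Finset ℝ}

/-- A non-reduced generating family can be improved by changing one of its members. -/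
lemma exists_update_of_not_isReducedFamily [DecidableEq ι] (hV : IsVLattice (zmul N) V A)
    {m : ι → N} {d : ι → ℝ} (h : ¬ IsReducedFamily V m d) :
    ∃ (i : ι) (y : N) (γ : ℝ), γ < d i ∧ y ∈ V γ ∧
      monomialSpan (Function.update m i y) {p | 0 ≤ p.2} = monomialSpan m {p | 0 ≤ p.2} := by
  simp only [IsReducedFamily, not_forall] at h
  obtain ⟨δ, c, hsupp, hmem, hc⟩ := h
  obtain ⟨γ, hγ, hmem⟩ := (mem_Vlt hV.mono).1 hmem
  obtain ⟨⟨i, k⟩, hp, hmin⟩ := Finset.exists_min_image c.support (fun p => p.2)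
    (Finsupp.support_nonempty_iff.2 hc)
  simp only at hmin
  set y : N := (T (-k) : L) • Finsupp.linearCombination ℂ (monomials m) c with hy
  have hysum : y = ∑ p ∈ c.support, c p • (T (p.2 - k) : L) • m p.1 := by
    rw [hy, Finsupp.linearCombination_apply, Finsupp.sum, Finset.smul_sum]
    refine Finset.sum_congr rfl fun p _ => ?_
    rw [monomials, smul_comm, T_smul_T_smul, neg_add_eq_sub]
  have hd := hsupp _ hp
  simp only at hd
  have hym : y ∈ monomialSpan m {p | 0 ≤ p.2} := by
    rw [hysum]
    refine sum_mem fun p hp' => Submodule.smul_mem _ _ (smul_mem_monomialSpan ?_)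
    simpa using hmin p hp'
  refine ⟨i, y, γ - k, by linarith, ?_, le_antisymm (monomialSpan_nonneg_le fun j => ?_)
    (monomialSpan_nonneg_le fun j => ?_)⟩
  · have := hV.T_smul_mem hmem (-k)
    rwa [Int.cast_neg, ← sub_eq_add_neg] at this
  · by_cases hj : j = i
    · subst hj
      rwa [Function.update_self]
    · rw [Function.update_of_ne hj]
      exact self_mem_monomialSpan m j
  · by_cases hj : j = i
    · subst hj
      have hc0 : c (j, k) ≠ 0 := Finsupp.mem_support_iff.1 hp
      have hsplit := Finset.add_sum_erase c.support
        (fun p => c p • (T (p.2 - k) : L) • m p.1) hp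
      rw [← hysum] at hsplit
      simp only [sub_self, T_zero, one_smul] at hsplit
      have hmj : m j = (c (j, k))⁻¹ •
          (y - ∑ p ∈ c.support.erase (j, k), c p • (T (p.2 - k) : L) • m p.1) := by
        rw [← hsplit, add_sub_cancel_right, smul_smul, inv_mul_cancel₀ hc0, one_smul]
      rw [hmj]
      refine Submodule.smul_mem _ _ (sub_mem ?_ (sum_mem fun p hp' => Submodule.smul_mem _ _ ?_))
      · simpa using self_mem_monomialSpan (Function.update m j y) j
      · rw [Finset.mem_erase] at hp'
        have hne : p.1 ≠ j := by
          intro hpj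
          apply hp'.1
          have h1 := hsupp p hp'.2
          rw [hpj] at h1
          have h2 : (p.2 : ℝ) = k := by linarith
          exact Prod.ext hpj (by exact_mod_cast h2)
        rw [← Function.update_of_ne hne y m]
        refine smul_mem_monomialSpan ?_
        simpa using hmin p hp'.2
    · have := self_mem_monomialSpan (Function.update m i y) j
      rwa [Function.update_of_ne hj] at this

lemma exists_isReducedFamily [Fintype ι] (hV : IsVLattice (zmul N) V A) (e : Module.Basis ι L N) :
    ∃ (e' : Module.Basis ι L N) (d : ι → ℝ),
      monomialSpan e' {p | 0 ≤ p.2} = monomialSpan e {p | 0 ≤ p.2} ∧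
      (∀ i, e' i ∈ V (d i)) ∧ IsReducedFamily V e' d := by
  classical
  obtain ⟨α, hα⟩ := hV.exists_inf_eq_bot e
  have hjump : ∀ e' : Module.Basis ι L N,
      monomialSpan e' {p | 0 ≤ p.2} = monomialSpan e {p | 0 ≤ p.2} →
      ∀ i b, e' i ∈ V b → ∃ t ∈ jumpSet A α b, e' i ∈ V t := by
    intro e' he' i b hb
    refine hV.exists_jump_of_mem hb fun hmem => e'.ne_zero i ?_
    have : e' i ∈ V α ⊓ monomialSpan e {p | 0 ≤ p.2} := by
      refine ⟨hmem, he' ▸ self_mem_monomialSpan e' i⟩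
    rwa [hα, mem_bot] at this
  have main : ∀ (n : ℕ) (e' : Module.Basis ι L N) (d : ι → ℝ),
      monomialSpan e' {p | 0 ≤ p.2} = monomialSpan e {p | 0 ≤ p.2} →
      (∀ i, e' i ∈ V (d i)) → (∀ i, d i ∈ jumpSet A α (d i)) →
      ∑ i, (jumpSet A α (d i)).ncard ≤ n →
      ∃ (e' : Module.Basis ι L N) (d : ι → ℝ),
        monomialSpan e' {p | 0 ≤ p.2} = monomialSpan e {p | 0 ≤ p.2} ∧
        (∀ i, e' i ∈ V (d i)) ∧ IsReducedFamily V e' d := by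
    intro n
    induction n using Nat.strong_induction_on with
    | _ n ih =>
      intro e' d he' hmem hd hn
      by_cases hred : IsReducedFamily V e' d
      · exact ⟨e', d, he', hmem, hred⟩
      obtain ⟨i, y, γ, hγ, hy, hspan⟩ := hV.exists_update_of_not_isReducedFamily hred
      obtain ⟨e'', he''⟩ := exists_basis_of_monomialSpan_eq e _ (hspan.trans he')
      rw [← he''] at hspan
      have hyi : e'' i = y := by rw [he'', Function.update_self]
      obtain ⟨t, ht, hyt⟩ := hjump e'' (hspan.trans he') i γ (hyi ▸ hy)
      have hlt : ∑ j, (jumpSet A α (Function.update d i t j)).ncard <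
          ∑ j, (jumpSet A α (d j)).ncard := by
        have hi : (jumpSet A α t).ncard < (jumpSet A α (d i)).ncard :=
          ncard_jumpSet_lt (hd i) (ht.2.1.trans_lt hγ)
        refine Finset.sum_lt_sum (fun j _ => ?_) ⟨i, Finset.mem_univ _, ?_⟩
        · by_cases hj : j = i
          · subst hj
            rw [Function.update_self]
            exact hi.le
          · rw [Function.update_of_ne hj]
        · rwa [Function.update_self]
      refine ih _ (hlt.trans_le hn) e'' (Function.update d i t) (hspan.trans he')
        (fun j => ?_) (fun j => ?_) le_rfl
      · by_cases hj : j = i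
        · subst hj
          rwa [Function.update_self]
        · rw [Function.update_of_ne hj, he'', Function.update_of_ne hj]
          exact hmem j
      · by_cases hj : j = i
        · subst hj
          rw [Function.update_self]
          exact ⟨ht.1, le_rfl, ht.2.2⟩
        · rw [Function.update_of_ne hj]
          exact hd j
  have hstart : ∀ i, ∃ t, t ∈ jumpSet A α t ∧ e i ∈ V t := by
    intro i
    obtain ⟨c, hc⟩ := hV.exists_mem (e i)
    obtain ⟨t, ht, h⟩ := hjump e rfl i c hc
    exact ⟨t, ⟨ht.1, le_rfl, ht.2.2⟩, h⟩
  choose d hd hmem using hstart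
  exact main _ e d rfl hmem hd le_rfl

lemma eq_monomialSpan_of_isReducedFamily (hV : IsVLattice (zmul N) V A) (e : Module.Basis ι L N)
    {d : ι → ℝ} (hmem : ∀ i, e i ∈ V (d i)) (hred : IsReducedFamily V e d) (β : ℝ) :
    V β = monomialSpan e {p | (p.2 : ℝ) + d p.1 ≤ β} := by
  classical
  have hmon : ∀ p : ι × ℤ, monomials e p ∈ V ((p.2 : ℝ) + d p.1) := fun p => by
    rw [add_comm]
    exact hV.T_smul_mem (hmem p.1) p.2
  refine le_antisymm (fun x hx => ?_)
    (monomialSpan_le.2 fun p hp => hV.mono hp (hmon p))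
  rw [mem_monomialSpan]
  set c := (monomialBasis e).repr x with hc
  have hxc : Finsupp.linearCombination ℂ (monomials e) c = x := by
    rw [← coe_monomialBasis, hc, Module.Basis.linearCombination_repr]
  by_contra hnot
  obtain ⟨q, hq, hqβ⟩ := Set.not_subset.1 hnot
  obtain ⟨p, hp, hmax⟩ := Finset.exists_max_image c.support (fun p => (p.2 : ℝ) + d p.1) ⟨q, hq⟩
  have hβ : β < (p.2 : ℝ) + d p.1 := lt_of_lt_of_le (not_le.1 hqβ) (hmax q hq)
  set δ := (p.2 : ℝ) + d p.1 with hδ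
  have hdec := Finsupp.filter_add_filter_not c (fun q => (q.2 : ℝ) + d q.1 = δ)
  have hrest : Finsupp.linearCombination ℂ (monomials e)
      (c.filter fun q => ¬ ((q.2 : ℝ) + d q.1 = δ)) ∈ Vlt V δ := by
    rw [Finsupp.linearCombination_apply, Finsupp.sum]
    refine sum_mem fun q hq => Submodule.smul_mem _ _ ?_
    rw [Finsupp.support_filter, Finset.mem_filter] at hq
    exact (mem_Vlt hV.mono).2 ⟨_, lt_of_le_of_ne (hmax q hq.1) hq.2, hmon q⟩
  have htop : Finsupp.linearCombination ℂ (monomials e)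
      (c.filter fun q => (q.2 : ℝ) + d q.1 = δ) ∈ Vlt V δ := by
    have : Finsupp.linearCombination ℂ (monomials e)
        (c.filter fun q => (q.2 : ℝ) + d q.1 = δ) = x - Finsupp.linearCombination ℂ (monomials e)
        (c.filter fun q => ¬ ((q.2 : ℝ) + d q.1 = δ)) := by
      rw [eq_sub_iff_add_eq, ← map_add, hdec, hxc]
    rw [this]
    exact sub_mem ((mem_Vlt hV.mono).2 ⟨β, hβ, hx⟩) hrest
  have hzero := hred δ _ (fun q hq => by
    rw [Finsupp.support_filter, Finset.mem_filter] at hq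
    exact hq.2) htop
  have hcp : c p = 0 := by
    have := DFunLike.congr_fun hzero p
    rwa [Finsupp.filter_apply_pos (fun q : ι × ℤ => (q.2 : ℝ) + d q.1 = δ) c hδ.symm] at this
  exact Finsupp.mem_support_iff.1 hp hcp

/-- Simultaneous splitting of a free `ℂ[z]`-lattice and a V-lattice filtration. -/
theorem exists_splitting {M : Submodule ℂ N} {r : ℕ} (hV : IsVLattice (zmul N) V A)
    (hM : IsFreeLattice (zmul N) M r) :
    ∃ (e : Module.Basis (Fin r) L N) (d : Fin r → ℝ),
      M = monomialSpan e {p | 0 ≤ p.2} ∧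
      ∀ β, V β = monomialSpan e {p | (p.2 : ℝ) + d p.1 ≤ β} := by
  obtain ⟨e₀, he₀⟩ := hM.exists_basis
  obtain ⟨e, d, he, hmem, hred⟩ := hV.exists_isReducedFamily e₀
  exact ⟨e, d, he₀.trans he.symm, hV.eq_monomialSpan_of_isReducedFamily e hmem hred⟩

open Polynomial in
lemma exists_polynomial (hV : IsVLattice (zmul N) V A) {nab : N →ₗ[ℂ] N} {ν : ℕ}
    (hnil : ∀ β : ℝ, ∀ x ∈ V β,
      ((nab + (β : ℂ) • (LinearMap.id : N →ₗ[ℂ] N)) ^ ν) x ∈ Vlt V β) {a b : ℝ} (hab : a ≤ b) :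
    ∃ P : ℂ[X], (∀ s, P.eval s = 0 → ∃ t : ℝ, a < t ∧ t ≤ b ∧ s = -(t : ℂ)) ∧
      ∀ x ∈ V b, aeval (R := ℂ) (A := Module.End ℂ N) nab P x ∈ V a := by
  obtain ⟨n, hn⟩ : ∃ n, (jumpSet A a b).ncard = n := ⟨_, rfl⟩
  induction n using Nat.strong_induction_on generalizing b with
  | _ n ih =>
    rcases (jumpSet A a b).eq_empty_or_nonempty with h | h
    · exact ⟨1, by simp, fun x hx => by simpa [hV.eq_of_jumpSet_eq_empty hab h] using hx⟩
    obtain ⟨t, ht, hVt⟩ := hV.exists_max_jump h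
    obtain ⟨b', hb', hmax⟩ := Set.exists_max_image
      (insert a {u | u ∈ jumpSet A a b ∧ u < t}) id
      (((jumpSet_finite A a b).subset fun u hu => hu.1).insert a) ⟨a, Set.mem_insert _ _⟩
    have hb't : b' < t := by
      rcases hb' with rfl | hb'
      · exact ht.1
      · exact hb'.2
    have hab' : a ≤ b' := hmax a (Set.mem_insert _ _)
    have hlt : Vlt V t ≤ V b' := by
      intro x hx
      obtain ⟨δ, hδ, hx⟩ := (mem_Vlt hV.mono).1 hx
      by_contra hnot
      obtain ⟨u, hu, -⟩ := hV.exists_jump_of_mem hx hnot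
      have hut := hu.2.1.trans_lt hδ
      exact absurd (hmax u (Or.inr ⟨⟨hab'.trans_lt hu.1, hut.le.trans ht.2.1, hu.2.2⟩, hut⟩))
        (not_le.2 hu.1)
    obtain ⟨P, hP, hPV⟩ := ih _ (hn ▸ ncard_jumpSet_lt ht hb't) hab' rfl
    refine ⟨P * (X + Polynomial.C (t : ℂ)) ^ ν, fun s hs => ?_, fun x hx => ?_⟩
    · rw [eval_mul, mul_eq_zero] at hs
      rcases hs with hs | hs
      · obtain ⟨u, h1, h2, h3⟩ := hP s hs
        exact ⟨u, h1, (h2.trans hb't.le).trans ht.2.1, h3⟩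
      · rw [eval_pow] at hs
        have := eq_zero_of_pow_eq_zero hs
        rw [eval_add, eval_X, eval_C] at this
        exact ⟨t, ht.1, ht.2.1, eq_neg_of_add_eq_zero_left this⟩
    · rw [← hVt] at hx
      have h1 := hPV _ (hlt (hnil t x hx))
      have h2 : aeval (R := ℂ) (A := Module.End ℂ N) nab ((X + Polynomial.C (t : ℂ)) ^ ν) =
          (nab + (t : ℂ) • (LinearMap.id : N →ₗ[ℂ] N)) ^ ν := by
        rw [map_pow, map_add, aeval_X, aeval_C, Module.algebraMap_end_eq_smul_id]
      rw [map_mul, Module.End.mul_apply, h2]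
      exact h1

lemma aeval_mem {Q : Submodule ℂ N} {nab : N →ₗ[ℂ] N} (h : ∀ x ∈ Q, nab x ∈ Q)
    (P : Polynomial ℂ) {x : N} (hx : x ∈ Q) :
    Polynomial.aeval (R := ℂ) (A := Module.End ℂ N) nab P x ∈ Q := by
  rw [Polynomial.aeval_endomorphism, Polynomial.sum]
  exact sum_mem fun n _ => Submodule.smul_mem _ _ (Module.End.pow_apply_mem_of_forall_mem n h x hx)

/-- A V-lattice filtration on which `∇ + β` is nilpotent on the graded pieces is contained in
any other one with the same property. -/
lemma le_of_nilpotent (hV : IsVLattice (zmul N) V A) {U : ℝ → Submodule ℂ N} {B : Finset ℝ}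
    (hU : IsVLattice (zmul N) U B) {nab : N →ₗ[ℂ] N} {ν ν' : ℕ}
    (hstab : ∀ β : ℝ, ∀ x ∈ U β, nab x ∈ U β)
    (hnil : ∀ β : ℝ, ∀ x ∈ V β,
      ((nab + (β : ℂ) • (LinearMap.id : N →ₗ[ℂ] N)) ^ ν) x ∈ Vlt V β)
    (hnil' : ∀ β : ℝ, ∀ x ∈ U β,
      ((nab + (β : ℂ) • (LinearMap.id : N →ₗ[ℂ] N)) ^ ν') x ∈ Vlt U β) (β : ℝ) :
    V β ≤ U β := by
  obtain ⟨c, hc⟩ := hV.exists_le hU.mono hU.exists_mem (fun c x hx => hU.zinv_stable c x hx) β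
  obtain ⟨n, hn⟩ := exists_nat_ge (c - β)
  have hsub : V (β - n) ≤ U β := by
    intro x hx
    have h1 := hV.T_smul_mem hx n
    rw [Int.cast_natCast, sub_add_cancel] at h1
    have h2 := hU.T_smul_mem (hc h1) (-n)
    rw [T_smul_T_smul, neg_add_cancel, T_zero, one_smul] at h2
    refine hU.mono ?_ h2
    push_cast
    linarith
  obtain ⟨P, hP, hPV⟩ := hV.exists_polynomial hnil (show β - n ≤ β by simp)
  obtain ⟨R, hR, hRU⟩ := hU.exists_polynomial hnil' (le_max_left β c)
  have hcop : IsCoprime P R := by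
    rw [Polynomial.isCoprime_iff_aeval_ne_zero_of_isAlgClosed ℂ ℂ]
    intro s
    by_contra! hs
    simp only [Polynomial.coe_aeval_eq_eval] at hs
    obtain ⟨t, -, ht, rfl⟩ := hP s hs.1
    obtain ⟨u, hu, -, hut⟩ := hR _ hs.2
    have : t = u := by exact_mod_cast neg_injective hut
    linarith
  obtain ⟨F, G, hFG⟩ := hcop
  intro x hx
  have h1 := aeval_mem (hstab β) F (hsub (hPV x hx))
  have h2 := aeval_mem (hstab β) G (hRU x (hU.mono (le_max_right β c) (hc hx)))
  have h3 := add_mem h1 h2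
  rw [← Module.End.mul_apply, ← Module.End.mul_apply, ← LinearMap.add_apply, ← map_mul, ← map_mul,
    ← map_add, hFG, map_one, Module.End.one_apply] at h3
  exact h3

/-- The filtration attached to a basis with exponents is a V-lattice filtration. -/
lemma of_basis [Fintype ι] (e : Module.Basis ι L N) (d : ι → ℝ) :
    IsVLattice (zmul N) (fun β => monomialSpan e {p | (p.2 : ℝ) + d p.1 ≤ β})
      (Finset.univ.image fun i => Int.fract (d i)) where
  mono a b hab := monomialSpan_mono fun p (hp : _ ≤ a) => hp.trans hab
  map_z β := by
    refine le_antisymm ?_ fun x hx => ?_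
    · rw [map_le_iff_le_comap]
      intro x hx
      refine T_smul_mem_monomialSpan (fun p (hp : _ ≤ β) => ?_) hx
      show ((1 + p.2 : ℤ) : ℝ) + d p.1 ≤ β + 1
      push_cast; linarith
    · refine ⟨(T (-1) : L) • x, ?_, ?_⟩
      · refine T_smul_mem_monomialSpan (fun p (hp : _ ≤ β + 1) => ?_) hx
        show ((-1 + p.2 : ℤ) : ℝ) + d p.1 ≤ β
        push_cast; linarith
      · exact (zmul N).apply_symm_apply x
  zinv_stable β x hx := by
    refine T_smul_mem_monomialSpan (fun p (hp : _ ≤ β) => ?_) hx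
    show ((-1 + p.2 : ℤ) : ℝ) + d p.1 ≤ β
    push_cast; linarith
  fg_zinv β := by
    classical
    refine ⟨Finset.univ.image fun i => (T ⌊β - d i⌋ : L) • e i, ?_, le_antisymm ?_ ?_⟩
    · intro x hx
      simp only [Finset.coe_image, Finset.coe_univ, Set.image_univ, Set.mem_range] at hx
      obtain ⟨i, rfl⟩ := hx
      refine smul_mem_monomialSpan ?_
      show (⌊β - d i⌋ : ℝ) + d i ≤ β
      linarith [Int.floor_le (β - d i)]
    · rw [monomialSpan_le]
      rintro ⟨i, k⟩ (hp : (k : ℝ) + d i ≤ β)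
      have hk : k ≤ ⌊β - d i⌋ := Int.le_floor.2 (by linarith)
      refine subset_span ⟨(⌊β - d i⌋ - k).toNat, _, Finset.mem_image_of_mem _ (Finset.mem_univ i), ?_⟩
      rw [zmul_symm_pow_apply, T_smul_T_smul]
      congr 2
      simp only
      omega
    · rw [span_le]
      rintro _ ⟨k, s, hs, rfl⟩
      simp only [Finset.mem_image, Finset.mem_univ, true_and] at hs
      obtain ⟨i, rfl⟩ := hs
      rw [zmul_symm_pow_apply, T_smul_T_smul]
      refine smul_mem_monomialSpan ?_
      show ((-(k : ℤ) + ⌊β - d i⌋ : ℤ) : ℝ) + d i ≤ β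
      push_cast
      linarith [Int.floor_le (β - d i), (Nat.cast_nonneg k : (0 : ℝ) ≤ k)]
  span_laurent β := by
    rw [eq_top_iff, ← monomialSpan_univ e, monomialSpan_le]
    rintro ⟨i, k⟩ -
    refine subset_span ⟨k - ⌊β - d i⌋, (T ⌊β - d i⌋ : L) • e i, smul_mem_monomialSpan ?_, ?_⟩
    · show (⌊β - d i⌋ : ℝ) + d i ≤ β
      linarith [Int.floor_le (β - d i)]
    · rw [zmul_zpow_apply, T_smul_T_smul, sub_add_cancel]
  jumpsIn a ha := by
    simp only [Finset.mem_image, Finset.mem_univ, true_and] at ha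
    obtain ⟨i, rfl⟩ := ha
    exact ⟨Int.fract_nonneg _, Int.fract_lt_one _⟩
  jumps β γ hβγ h := by
    congr 1
    ext p
    refine ⟨fun (hp : _ ≤ β) => hp.trans hβγ, fun (hp : _ ≤ γ) => ?_⟩
    by_contra hnot
    refine h (Int.fract (d p.1)) (Finset.mem_image_of_mem _ (Finset.mem_univ _))
      (p.2 + ⌊d p.1⌋) ?_
    have heq : Int.fract (d p.1) + ((p.2 + ⌊d p.1⌋ : ℤ) : ℝ) = (p.2 : ℝ) + d p.1 := by
      push_cast
      linarith [Int.fract_add_floor (d p.1)]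
    rw [heq]
    exact ⟨not_le.1 hnot, hp⟩

end IsVLattice

lemma FHNpoly_eq_monomialSpan (e : Module.Basis ι L N) (d : ι → ℝ) {V : ℝ → Submodule ℂ N}
    (hV : ∀ β, V β = monomialSpan e {p | (p.2 : ℝ) + d p.1 ≤ β}) (β : ℝ) :
    FHNpoly (zmul N) V (monomialSpan e {p | 0 ≤ p.2}) β =
      monomialSpan e {p | 0 ≤ p.2 ∧ d p.1 ≤ β} := by
  rw [FHNpoly, hV, monomialSpan_inf]
  refine le_antisymm (span_le.2 ?_) (monomialSpan_le.2 ?_)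
  · rintro _ ⟨k, v, hv, rfl⟩
    rw [zmul_zpow_apply]
    refine T_smul_mem_monomialSpan ?_ hv
    rintro p ⟨(h1 : (p.2 : ℝ) + d p.1 ≤ β), (h2 : 0 ≤ p.2)⟩
    have : (0 : ℝ) ≤ p.2 := by exact_mod_cast h2
    exact ⟨by simp only; omega, by simp only; linarith⟩
  · rintro ⟨i, k⟩ ⟨(hk : 0 ≤ k), (hd : d i ≤ β)⟩
    obtain ⟨n, rfl⟩ := Int.eq_ofNat_of_zero_le hk
    refine subset_span ⟨n, (T 0 : L) • e i, smul_mem_monomialSpan ⟨?_, ?_⟩, ?_⟩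
    · simpa using hd
    · simp
    · rw [zmul_zpow_apply, T_zero, one_smul]

end LaurentModule

section Tensor

set_option linter.unusedSectionVars false

variable {N₁ N₂ : Type*}
  [AddCommGroup N₁] [Module L N₁] [Module ℂ N₁] [IsScalarTower ℂ L N₁]
  [AddCommGroup N₂] [Module L N₂] [Module ℂ N₂] [IsScalarTower ℂ L N₂]
variable {ι κ : Type*}

lemma tmul_complex_smul (c : ℂ) (x : N₁) (y : N₂) : x ⊗ₜ[L] (c • y) = c • (x ⊗ₜ[L] y) := by
  rw [← algebraMap_smul L c y, TensorProduct.tmul_smul, algebraMap_smul]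

lemma T_smul_tmul_T_smul (a b : ℤ) (x : N₁) (y : N₂) :
    ((T a : L) • x) ⊗ₜ[L] ((T b : L) • y) = (T (a + b) : L) • (x ⊗ₜ[L] y) := by
  rw [TensorProduct.tmul_smul, ← TensorProduct.smul_tmul', T_smul_T_smul, add_comm]

lemma tmul_mem_of_mem_span {s : Set N₁} {t : Set N₂} {Q : Submodule ℂ (N₁ ⊗[L] N₂)}
    (h : ∀ x ∈ s, ∀ y ∈ t, x ⊗ₜ[L] y ∈ Q) {x : N₁} {y : N₂} (hx : x ∈ span ℂ s)
    (hy : y ∈ span ℂ t) : x ⊗ₜ[L] y ∈ Q := by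
  induction hx using span_induction with
  | mem x hx =>
    induction hy using span_induction with
    | mem y hy => exact h x hx y hy
    | zero => simp
    | add y y' _ _ hy hy' => rw [TensorProduct.tmul_add]; exact add_mem hy hy'
    | smul c y _ hy => rw [tmul_complex_smul]; exact Submodule.smul_mem _ _ hy
  | zero => simp
  | add x x' _ _ hx hx' => rw [TensorProduct.add_tmul]; exact add_mem hx hx'
  | smul c x _ hx => rw [← TensorProduct.smul_tmul']; exact Submodule.smul_mem _ _ hx

lemma tmul_mem_monomialSpan {e : Module.Basis ι L N₁} {f : Module.Basis κ L N₂}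
    {S : Set (ι × ℤ)} {S' : Set (κ × ℤ)} {S'' : Set ((ι × κ) × ℤ)}
    (h : ∀ p ∈ S, ∀ q ∈ S', ((p.1, q.1), p.2 + q.2) ∈ S'') {x : N₁} {y : N₂}
    (hx : x ∈ monomialSpan e S) (hy : y ∈ monomialSpan f S') :
    x ⊗ₜ[L] y ∈ monomialSpan (e.tensorProduct f) S'' := by
  refine tmul_mem_of_mem_span ?_ hx hy
  rintro _ ⟨p, hp, rfl⟩ _ ⟨q, hq, rfl⟩
  rw [monomials, monomials, T_smul_tmul_T_smul, ← Module.Basis.tensorProduct_apply]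
  exact smul_mem_monomialSpan (h p hp q hq)

/-- A derivation-like operator on a tensor product maps `x ⊗ y` into `Q` after `a + b` iterations
when `Q` absorbs the tensors in which one factor has been hit often enough. -/
lemma pow_apply_tmul_mem {nabla : N₁ ⊗[L] N₂ →ₗ[ℂ] N₁ ⊗[L] N₂} {D₁ : N₁ →ₗ[ℂ] N₁}
    {D₂ : N₂ →ₗ[ℂ] N₂}
    (h : ∀ x y, nabla (x ⊗ₜ[L] y) = D₁ x ⊗ₜ[L] y + x ⊗ₜ[L] D₂ y)
    {Q : Submodule ℂ (N₁ ⊗[L] N₂)} {x : N₁} {y : N₂} {a b : ℕ}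
    (hQ : ∀ i j : ℕ, a ≤ i ∨ b ≤ j → (D₁ ^ i) x ⊗ₜ[L] (D₂ ^ j) y ∈ Q) :
    (nabla ^ (a + b)) (x ⊗ₜ[L] y) ∈ Q := by
  have main : ∀ n i j : ℕ, a + b ≤ n + i + j →
      (nabla ^ n) ((D₁ ^ i) x ⊗ₜ[L] (D₂ ^ j) y) ∈ Q := by
    intro n
    induction n with
    | zero =>
      intro i j hij
      exact hQ i j (by omega)
    | succ n ih =>
      intro i j hij
      rw [pow_succ, Module.End.mul_apply, h, map_add, ← Module.End.mul_apply D₁,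
        ← Module.End.mul_apply D₂, ← pow_succ', ← pow_succ']
      exact add_mem (ih (i + 1) j (by omega)) (ih i (j + 1) (by omega))
  simpa using main (a + b) 0 0 (by omega)

lemma span_tmul_monomialSpan (e : Module.Basis ι L N₁) (f : Module.Basis κ L N₂) :
    span ℂ {x : N₁ ⊗[L] N₂ | ∃ a ∈ monomialSpan e {p | 0 ≤ p.2},
      ∃ b ∈ monomialSpan f {p | 0 ≤ p.2}, x = a ⊗ₜ[L] b} =
      monomialSpan (e.tensorProduct f) {p | 0 ≤ p.2} := by
  refine le_antisymm (span_le.2 ?_) (monomialSpan_le.2 ?_)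
  · rintro _ ⟨a, ha, b, hb, rfl⟩
    refine tmul_mem_monomialSpan (fun p (hp : 0 ≤ p.2) q (hq : 0 ≤ q.2) => ?_) ha hb
    show 0 ≤ p.2 + q.2
    omega
  · intro p (hp : 0 ≤ p.2)
    rw [Module.Basis.tensorProduct_apply, TensorProduct.smul_tmul']
    exact subset_span ⟨_, T_smul_mem_monomialSpan_nonneg hp (self_mem_monomialSpan e _), _,
      self_mem_monomialSpan f _, rfl⟩

end Tensor

variable {N₁ N₂ : Type*}
  [AddCommGroup N₁] [Module L N₁] [Module ℂ N₁] [IsScalarTower ℂ L N₁]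
  [AddCommGroup N₂] [Module L N₂] [Module ℂ N₂] [IsScalarTower ℂ L N₂]

/-- Remark 3.2.12 (tensor product formula for the Harder–Narasimhan filtration).
For any V-lattice filtration `W` on `N = N₁ ⊗_{ℂ[z,z⁻¹]} N₂` stable under the
tensor-product connection `∇` with `(∇ + β·id)^ν (W_β) ⊆ W_{<β}`, one has, for every
`β ∈ ℝ`:
`F^HN_β M := ℂ[z]·(W_β ∩ M) = Σ_{β₁+β₂=β} (image in M of F^HN_{β₁}M₁ ⊗_{ℂ[z]} F^HN_{β₂}M₂)`. -/
theorem statement11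
    (M₁ : Submodule ℂ N₁) (M₂ : Submodule ℂ N₂) (r₁ r₂ : ℕ)
    (V₁ : ℝ → Submodule ℂ N₁) (V₂ : ℝ → Submodule ℂ N₂) (A₁ A₂ : Finset ℝ)
    (hM₁ : IsFreeLattice (zmul N₁) M₁ r₁) (hM₂ : IsFreeLattice (zmul N₂) M₂ r₂)
    (hV₁ : IsVLattice (zmul N₁) V₁ A₁) (hV₂ : IsVLattice (zmul N₂) V₂ A₂)
    (nab₁ : N₁ →ₗ[ℂ] N₁) (nab₂ : N₂ →ₗ[ℂ] N₂)
    (hLeib₁ : ∀ x : N₁, nab₁ ((T 1 : L) • x) = (T 1 : L) • nab₁ x - (T 1 : L) • x)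
    (hLeib₂ : ∀ y : N₂, nab₂ ((T 1 : L) • y) = (T 1 : L) • nab₂ y - (T 1 : L) • y)
    (hMnab₁ : ∀ m ∈ M₁, (T 1 : L) • nab₁ m ∈ M₁)
    (hMnab₂ : ∀ m ∈ M₂, (T 1 : L) • nab₂ m ∈ M₂)
    (hstab₁ : ∀ β : ℝ, ∀ x ∈ V₁ β, nab₁ x ∈ V₁ β)
    (hstab₂ : ∀ β : ℝ, ∀ y ∈ V₂ β, nab₂ y ∈ V₂ β)
    (ν₁ ν₂ : ℕ)
    (hnil₁ : ∀ β : ℝ, ∀ x ∈ V₁ β,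
      ((nab₁ + (β : ℂ) • (LinearMap.id : N₁ →ₗ[ℂ] N₁)) ^ ν₁) x ∈ Vlt V₁ β)
    (hnil₂ : ∀ β : ℝ, ∀ y ∈ V₂ β,
      ((nab₂ + (β : ℂ) • (LinearMap.id : N₂ →ₗ[ℂ] N₂)) ^ ν₂) y ∈ Vlt V₂ β)
    (nabla : N₁ ⊗[L] N₂ →ₗ[ℂ] N₁ ⊗[L] N₂)
    (hnabla : ∀ (x : N₁) (y : N₂),
      nabla (x ⊗ₜ[L] y) = (nab₁ x) ⊗ₜ[L] y + x ⊗ₜ[L] (nab₂ y))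
    (W : ℝ → Submodule ℂ (N₁ ⊗[L] N₂)) (AW : Finset ℝ)
    (hW : IsVLattice (zmul (N₁ ⊗[L] N₂)) W AW)
    (hWnab : ∀ β : ℝ, ∀ u ∈ W β, nabla u ∈ W β)
    (ν : ℕ)
    (hWnil : ∀ β : ℝ, ∀ u ∈ W β,
      ((nabla + (β : ℂ) • (LinearMap.id : N₁ ⊗[L] N₂ →ₗ[ℂ] N₁ ⊗[L] N₂)) ^ ν) u ∈
        Vlt W β) :
    ∀ β : ℝ,
      FHNpoly (zmul (N₁ ⊗[L] N₂)) W
          (Submodule.span ℂ {x : N₁ ⊗[L] N₂ | ∃ a ∈ M₁, ∃ b ∈ M₂, x = a ⊗ₜ[L] b}) β =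
        ⨆ (p : ℝ × ℝ) (_ : p.1 + p.2 = β),
          Submodule.span ℂ
            {x : N₁ ⊗[L] N₂ | ∃ k : ℕ, ∃ a ∈ FHNpoly (zmul N₁) V₁ M₁ p.1,
              ∃ b ∈ FHNpoly (zmul N₂) V₂ M₂ p.2,
              x = ((zmul (N₁ ⊗[L] N₂)) ^ (k : ℤ)) (a ⊗ₜ[L] b)} := by
  obtain ⟨e, d, rfl, hVe⟩ := hV₁.exists_splitting hM₁
  obtain ⟨f, d', rfl, hVf⟩ := hV₂.exists_splitting hM₂
  set D : Fin r₁ × Fin r₂ → ℝ := fun p => d p.1 + d' p.2 with hD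
  set U : ℝ → Submodule ℂ (N₁ ⊗[L] N₂) :=
    fun β => monomialSpan (e.tensorProduct f) {p | (p.2 : ℝ) + D p.1 ≤ β} with hUdef
  have hU := IsVLattice.of_basis (e.tensorProduct f) D
  have htmul : ∀ {a b : ℝ} {x : N₁} {y : N₂}, x ∈ V₁ a → y ∈ V₂ b → x ⊗ₜ[L] y ∈ U (a + b) := by
    intro a b x y hx hy
    rw [hVe] at hx
    rw [hVf] at hy
    refine tmul_mem_monomialSpan ?_ hx hy
    intro p (hp : (p.2 : ℝ) + d p.1 ≤ a) q (hq : (q.2 : ℝ) + d' q.1 ≤ b)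
    show ((p.2 + q.2 : ℤ) : ℝ) + (d p.1 + d' q.1) ≤ a + b
    push_cast
    linarith
  have hle : ∀ {β : ℝ} {Q : Submodule ℂ (N₁ ⊗[L] N₂)},
      (∀ a b : ℝ, a + b = β → ∀ x ∈ V₁ a, ∀ y ∈ V₂ b, x ⊗ₜ[L] y ∈ Q) → U β ≤ Q := by
    intro β Q h
    rw [hUdef, monomialSpan_le]
    intro p (hp : (p.2 : ℝ) + (d p.1.1 + d' p.1.2) ≤ β)
    rw [Module.Basis.tensorProduct_apply, TensorProduct.smul_tmul']
    refine h (p.2 + d p.1.1) (β - (p.2 + d p.1.1)) (by ring) _ ?_ _ ?_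
    · rw [hVe]
      refine smul_mem_monomialSpan ?_
      show (p.2 : ℝ) + d p.1.1 ≤ p.2 + d p.1.1
      exact le_rfl
    · have h0 : (T 0 : L) • f p.1.2 ∈ V₂ (β - (p.2 + d p.1.1)) := by
        rw [hVf]
        refine smul_mem_monomialSpan ?_
        show ((0 : ℤ) : ℝ) + d' p.1.2 ≤ _
        push_cast
        linarith
      rwa [T_zero, one_smul] at h0
  have hUstab : ∀ β : ℝ, ∀ u ∈ U β, nabla u ∈ U β := by
    intro β
    refine hle (Q := (U β).comap nabla) fun a b hab x hx y hy => ?_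
    subst hab
    rw [mem_comap, hnabla]
    exact add_mem (htmul (hstab₁ a x hx) hy) (htmul hx (hstab₂ b y hy))
  have hUnil : ∀ β : ℝ, ∀ u ∈ U β,
      ((nabla + (β : ℂ) • (LinearMap.id : N₁ ⊗[L] N₂ →ₗ[ℂ] N₁ ⊗[L] N₂)) ^ (ν₁ + ν₂)) u ∈
        Vlt U β := by
    intro β
    refine hle (Q := (Vlt U β).comap _) fun a b hab x hx y hy => ?_
    subst hab
    rw [mem_comap]
    have hs₁ : ∀ x ∈ V₁ a, (nab₁ + (a : ℂ) • (LinearMap.id : N₁ →ₗ[ℂ] N₁)) x ∈ V₁ a :=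
      fun x hx => add_mem (hstab₁ a x hx) (Submodule.smul_mem _ _ hx)
    have hs₂ : ∀ y ∈ V₂ b, (nab₂ + (b : ℂ) • (LinearMap.id : N₂ →ₗ[ℂ] N₂)) y ∈ V₂ b :=
      fun y hy => add_mem (hstab₂ b y hy) (Submodule.smul_mem _ _ hy)
    refine pow_apply_tmul_mem (D₁ := nab₁ + (a : ℂ) • LinearMap.id)
      (D₂ := nab₂ + (b : ℂ) • LinearMap.id) (fun x y => ?_) fun i j hij => ?_
    · simp only [LinearMap.add_apply, LinearMap.smul_apply, LinearMap.id_apply, hnabla,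
        TensorProduct.add_tmul, TensorProduct.tmul_add, tmul_complex_smul,
        ← TensorProduct.smul_tmul', Complex.ofReal_add, add_smul]
      abel
    · rw [mem_Vlt hU.mono]
      have hx' := Module.End.pow_apply_mem_of_forall_mem i hs₁ x hx
      have hy' := Module.End.pow_apply_mem_of_forall_mem j hs₂ y hy
      rcases hij with hi | hj
      · have h1 := hnil₁ a _ (Module.End.pow_apply_mem_of_forall_mem (i - ν₁) hs₁ x hx)
        rw [← Module.End.mul_apply, ← pow_add, Nat.add_sub_cancel' hi, mem_Vlt hV₁.mono] at h1
        obtain ⟨γ, hγ, h1⟩ := h1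
        exact ⟨γ + b, by linarith, htmul h1 hy'⟩
      · have h1 := hnil₂ b _ (Module.End.pow_apply_mem_of_forall_mem (j - ν₂) hs₂ y hy)
        rw [← Module.End.mul_apply, ← pow_add, Nat.add_sub_cancel' hj, mem_Vlt hV₂.mono] at h1
        obtain ⟨γ, hγ, h1⟩ := h1
        exact ⟨a + γ, by linarith, htmul hx' h1⟩
  have hWU : W = U := funext fun β => le_antisymm
    (hW.le_of_nilpotent hU hUstab hWnil hUnil β) (hU.le_of_nilpotent hW hWnab hUnil hWnil β)
  intro β
  rw [span_tmul_monomialSpan, hWU, FHNpoly_eq_monomialSpan (e.tensorProduct f) D fun _ => rfl]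
  refine le_antisymm (monomialSpan_le.2 ?_) (iSup₂_le fun p hp => span_le.2 ?_)
  · rintro ⟨⟨i, j⟩, k⟩ ⟨(hk : 0 ≤ k), (hd : d i + d' j ≤ β)⟩
    refine mem_iSup_of_mem (d i, β - d i) (mem_iSup_of_mem (by simp) ?_)
    obtain ⟨n, rfl⟩ := Int.eq_ofNat_of_zero_le hk
    refine subset_span ⟨n, (T 0 : L) • e i, ?_, (T 0 : L) • f j, ?_, ?_⟩
    · rw [FHNpoly_eq_monomialSpan e d hVe]
      refine smul_mem_monomialSpan ?_
      show (0 : ℤ) ≤ 0 ∧ d i ≤ d i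
      exact ⟨le_rfl, le_rfl⟩
    · rw [FHNpoly_eq_monomialSpan f d' hVf]
      refine smul_mem_monomialSpan ?_
      show (0 : ℤ) ≤ 0 ∧ d' j ≤ β - d i
      exact ⟨le_rfl, by linarith⟩
    · rw [zmul_zpow_apply, T_zero, one_smul, one_smul, Module.Basis.tensorProduct_apply]
  · rintro _ ⟨k, a, ha, b, hb, rfl⟩
    rw [FHNpoly_eq_monomialSpan e d hVe] at ha
    rw [FHNpoly_eq_monomialSpan f d' hVf] at hb
    rw [zmul_zpow_apply]
    refine T_smul_mem_monomialSpan (S := {q | 0 ≤ q.2 ∧ D q.1 ≤ β}) ?_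
      (tmul_mem_monomialSpan ?_ ha hb)
    · rintro q ⟨h1, h2⟩
      show 0 ≤ (k : ℤ) + q.2 ∧ D q.1 ≤ β
      exact ⟨by omega, h2⟩
    · rintro q ⟨h1, h2⟩ q' ⟨h1', h2'⟩
      show 0 ≤ q.2 + q'.2 ∧ d q.1 + d' q'.1 ≤ β
      exact ⟨by omega, by linarith⟩
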